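/- Let n ≥ 2 and let I_n be the two-sided ideal of BB_n(R) generated by e_{n−1}. Then I_n equals the R-linear span of the set { a·e_{n−1}·b : a, b in the image of the canonical R-algebra homomorphism BB_{n−1}(R) → BB_n(R) }. -/

import Mathlib

namespace BMWB

inductive Gen (n : ℕ) : Type
  | X : Fin (n - 1) → Gen n
  | Xinv : Fin (n - 1) → Gen n
  | Y : 0 < n → Gen n
  | Yinv : 0 < n → Gen n

variable (R : Type) [CommRing R]

def fX {n : ℕ} (i : Fin (n - 1)) : FreeAlgebra R (Gen n) := FreeAlgebra.ι R (Gen.X i)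
def fXinv {n : ℕ} (i : Fin (n - 1)) : FreeAlgebra R (Gen n) := FreeAlgebra.ι R (Gen.Xinv i)
def fY {n : ℕ} (h : 0 < n) : FreeAlgebra R (Gen n) := FreeAlgebra.ι R (Gen.Y h)
def fYinv {n : ℕ} (h : 0 < n) : FreeAlgebra R (Gen n) := FreeAlgebra.ι R (Gen.Yinv h)
def fe {n : ℕ} (deli : R) (i : Fin (n - 1)) : FreeAlgebra R (Gen n) :=
  1 - deli • (fX R i - fXinv R i)

variable (lam lami deli q0 q1 A : R) (n : ℕ)

/-- The defining relations of the reduced Birman-Murakami-Wenzl algebra of Coxeter type B. -/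
inductive Rel : FreeAlgebra R (Gen n) → FreeAlgebra R (Gen n) → Prop
  | XXinv (i : Fin (n - 1)) : Rel (fX R i * fXinv R i) 1
  | XinvX (i : Fin (n - 1)) : Rel (fXinv R i * fX R i) 1
  | YYinv (h : 0 < n) : Rel (fY R h * fYinv R h) 1
  | YinvY (h : 0 < n) : Rel (fYinv R h * fY R h) 1
  | comm (i j : Fin (n - 1)) (h : (j : ℕ) + 1 < (i : ℕ)) :
      Rel (fX R i * fX R j) (fX R j * fX R i)
  | braid (i j : Fin (n - 1)) (h : (i : ℕ) + 1 = (j : ℕ)) :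
      Rel (fX R i * fX R j * fX R i) (fX R j * fX R i * fX R j)
  | Xe (i : Fin (n - 1)) : Rel (fX R i * fe R deli i) (lam • fe R deli i)
  | eX (i : Fin (n - 1)) : Rel (fe R deli i * fX R i) (lam • fe R deli i)
  | eXe (i j : Fin (n - 1)) (h : (j : ℕ) + 1 = (i : ℕ)) :
      Rel (fe R deli i * fX R j * fe R deli i) (lami • fe R deli i)
  | eXinve (i j : Fin (n - 1)) (h : (j : ℕ) + 1 = (i : ℕ)) :
      Rel (fe R deli i * fXinv R j * fe R deli i) (lam • fe R deli i)
  | bYXYX (h : 0 < n) (i : Fin (n - 1)) (hi : (i : ℕ) = 0) :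
      Rel (fX R i * fY R h * fX R i * fY R h) (fY R h * fX R i * fY R h * fX R i)
  | Ysq (h : 0 < n) : Rel (fY R h * fY R h) (q1 • fY R h + q0 • (1 : FreeAlgebra R (Gen n)))
  | YXYe (h : 0 < n) (i : Fin (n - 1)) (hi : (i : ℕ) = 0) :
      Rel (fY R h * fX R i * fY R h * fe R deli i) (fe R deli i)
  | Ycomm (h : 0 < n) (i : Fin (n - 1)) (hi : 0 < (i : ℕ)) :
      Rel (fY R h * fX R i) (fX R i * fY R h)
  | eYe (h : 0 < n) (i : Fin (n - 1)) (hi : (i : ℕ) = 0) :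
      Rel (fe R deli i * fY R h * fe R deli i) (A • fe R deli i)

/-- The reduced Birman-Murakami-Wenzl algebra of Coxeter type B, `BB_n(R)`,
presented by generators and relations. -/
abbrev BB : Type := RingQuot (Rel R lam lami deli q0 q1 A n)

noncomputable def mk : FreeAlgebra R (Gen n) →ₐ[R] BB R lam lami deli q0 q1 A n :=
  RingQuot.mkAlgHom R (Rel R lam lami deli q0 q1 A n)

/-- The generator `Y` (junk value `1` if `n = 0`). -/
noncomputable def YY : BB R lam lami deli q0 q1 A n :=
  if h : 0 < n then mk R lam lami deli q0 q1 A n (fY R h) else 1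

/-- The inverse of the generator `Y`. -/
noncomputable def YYi : BB R lam lami deli q0 q1 A n :=
  if h : 0 < n then mk R lam lami deli q0 q1 A n (fYinv R h) else 1

/-- The generator `X_i`, `1 ≤ i ≤ n-1` (junk value `1` out of range). -/
noncomputable def XX (i : ℕ) : BB R lam lami deli q0 q1 A n :=
  if h : i - 1 < n - 1 then mk R lam lami deli q0 q1 A n (fX R ⟨i - 1, h⟩) else 1

/-- The inverse `X_i⁻¹`. -/
noncomputable def XXi (i : ℕ) : BB R lam lami deli q0 q1 A n :=
  if h : i - 1 < n - 1 then mk R lam lami deli q0 q1 A n (fXinv R ⟨i - 1, h⟩) else 1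

/-- The element `e_i := 1 - δ⁻¹ (X_i - X_i⁻¹)`. -/
noncomputable def ee (i : ℕ) : BB R lam lami deli q0 q1 A n :=
  1 - deli • (XX R lam lami deli q0 q1 A n i - XXi R lam lami deli q0 q1 A n i)

/-- `Y_i := X_{i-1} ⋯ X_1 Y X_1⁻¹ ⋯ X_{i-1}⁻¹`. -/
noncomputable def Yn : ℕ → BB R lam lami deli q0 q1 A n
  | 0 => 1
  | 1 => YY R lam lami deli q0 q1 A n
  | (k + 2) => XX R lam lami deli q0 q1 A n (k + 1) * Yn (k + 1) * XXi R lam lami deli q0 q1 A n (k + 1)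

/-- `Y'_i := X_{i-1} ⋯ X_1 Y X_1 ⋯ X_{i-1}`. -/
noncomputable def Yp : ℕ → BB R lam lami deli q0 q1 A n
  | 0 => 1
  | 1 => YY R lam lami deli q0 q1 A n
  | (k + 2) => XX R lam lami deli q0 q1 A n (k + 1) * Yp (k + 1) * XX R lam lami deli q0 q1 A n (k + 1)

/-- The inverse of `Y'_i`. -/
noncomputable def Ypi : ℕ → BB R lam lami deli q0 q1 A n
  | 0 => 1
  | 1 => YYi R lam lami deli q0 q1 A n
  | (k + 2) => XXi R lam lami deli q0 q1 A n (k + 1) * Ypi (k + 1) * XXi R lam lami deli q0 q1 A n (k + 1)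

/-- The set of the images of the generators (and their inverses) of `BB_{m+1}` inside `BB_n`.
Its `Algebra.adjoin` is the image of the canonical algebra homomorphism `BB_{m+1} → BB_n`. -/
noncomputable def genSet (m : ℕ) : Set (BB R lam lami deli q0 q1 A n) :=
  {a | a = YY R lam lami deli q0 q1 A n ∨ a = YYi R lam lami deli q0 q1 A n ∨
    ∃ i, 1 ≤ i ∧ i ≤ m ∧ (a = XX R lam lami deli q0 q1 A n i ∨ a = XXi R lam lami deli q0 q1 A n i)}

/-- The image of the canonical algebra homomorphism `BB_{m+1}(R) → BB_n(R)`, realized as the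
subalgebra generated by the images of the generators `Y, Y⁻¹, X_1, …, X_m` (and inverses). -/
noncomputable def sub (m : ℕ) : Subalgebra R (BB R lam lami deli q0 q1 A n) :=
  Algebra.adjoin R (genSet R lam lami deli q0 q1 A n m)

/-- `X(i,j) = X_i X_{i+1} ⋯ X_j`. -/
noncomputable def Xprod (i j : ℕ) : BB R lam lami deli q0 q1 A n :=
  ((List.range (j + 1 - i)).map (fun k => XX R lam lami deli q0 q1 A n (i + k))).prod

/-- `E(i,j) = e_i e_{i+2} ⋯ e_j`. -/
noncomputable def Eprod (i j : ℕ) : BB R lam lami deli q0 q1 A n :=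
  ((List.range ((j - i) / 2 + 1)).map (fun k => ee R lam lami deli q0 q1 A n (i + 2 * k))).prod

/-- `H_1 = e_1`, `H_{m+1} = e_{m+1} X(m+2, 2m+1) X(m+1, 2m) H_m`. -/
noncomputable def H : ℕ → BB R lam lami deli q0 q1 A n
  | 0 => 1
  | 1 => ee R lam lami deli q0 q1 A n 1
  | (k + 2) => ee R lam lami deli q0 q1 A n (k + 2) *
      Xprod R lam lami deli q0 q1 A n (k + 3) (2 * k + 3) *
      Xprod R lam lami deli q0 q1 A n (k + 2) (2 * k + 2) * H (k + 1)

theorem mul_mul_of_mul_eq {M : Type*} [Semigroup M] {a b c : M} (h : a * b = c) (z : M) :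
    a * (b * z) = c * z := by
  rw [← mul_assoc, h]

section Abstract

variable {R A : Type*} [CommRing R] [Ring A] [Algebra R A]

/-- Two adjacent braid generators `P`, `Q` with inverses `Pi`, `Qi` and associated tangle
elements `p`, `f`, satisfying the Birman-Murakami-Wenzl relations in which the partial closure
is only required over `f`. -/
structure BraidPair (lam lami deli : R) (P Pi p Q Qi f : A) : Prop where
  lam_mul : lam * lami = 1
  P_Pi : P * Pi = 1
  Pi_P : Pi * P = 1
  Q_Qi : Q * Qi = 1
  Qi_Q : Qi * Q = 1
  p_eq : p = 1 - deli • (P - Pi)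
  f_eq : f = 1 - deli • (Q - Qi)
  braid : P * Q * P = Q * P * Q
  P_p : P * p = lam • p
  p_P : p * P = lam • p
  Q_f : Q * f = lam • f
  f_Q : f * Q = lam • f
  f_P_f : f * P * f = lami • f
  f_Pi_f : f * Pi * f = lam • f

theorem inv_mul_of_mul_eq_smul {lam lami : R} (h : lam * lami = 1) {Q Qi f : A}
    (hQ : Qi * Q = 1) (hf : Q * f = lam • f) : Qi * f = lami • f := by
  have hfe : lami • (Qi * (Q * f)) = Qi * f := by
    rw [hf, mul_smul_comm, smul_smul, mul_comm lami, h, one_smul]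
  rw [← hfe, ← mul_assoc, hQ, one_mul]

theorem mul_inv_of_mul_eq_smul {lam lami : R} (h : lam * lami = 1) {Q Qi f : A}
    (hQ : Q * Qi = 1) (hf : f * Q = lam • f) : f * Qi = lami • f := by
  have hfe : lami • (f * Q * Qi) = f * Qi := by
    rw [hf, smul_mul_assoc, smul_smul, mul_comm lami, h, one_smul]
  rw [← hfe, mul_assoc, hQ, mul_one]

namespace BraidPair

variable {lam lami deli : R} {P Pi p Q Qi f : A}

theorem Q_P_f (h : BraidPair lam lami deli P Pi p Q Qi f) : Q * (P * f) = p * (Q * P) := by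
  have hc : Q * (P * Qi) = Pi * (Q * P) := by
    calc Q * (P * Qi) = (Pi * P) * (Q * (P * Qi)) := by rw [h.Pi_P, one_mul]
      _ = Pi * (P * Q * P) * Qi := by simp only [mul_assoc]
      _ = Pi * (Q * P) * (Q * Qi) := by rw [h.braid]; simp only [mul_assoc]
      _ = Pi * (Q * P) := by rw [h.Q_Qi, mul_one]
  have hb := h.braid
  simp only [mul_assoc] at hb
  simp only [h.f_eq, h.p_eq, mul_sub, sub_mul, mul_one, one_mul, mul_smul_comm, smul_mul_assoc,
    hc, hb]

theorem P_Q_p (h : BraidPair lam lami deli P Pi p Q Qi f) : P * (Q * p) = f * (P * Q) := by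
  have hc : P * (Q * Pi) = Qi * (P * Q) := by
    calc P * (Q * Pi) = (Qi * Q) * (P * (Q * Pi)) := by rw [h.Qi_Q, one_mul]
      _ = Qi * (Q * P * Q) * Pi := by simp only [mul_assoc]
      _ = Qi * (P * Q) * (P * Pi) := by rw [← h.braid]; simp only [mul_assoc]
      _ = Qi * (P * Q) := by rw [h.P_Pi, mul_one]
  have hb := h.braid
  simp only [mul_assoc] at hb
  simp only [h.f_eq, h.p_eq, mul_sub, sub_mul, mul_one, one_mul, mul_smul_comm, smul_mul_assoc,
    hc, hb]

theorem f_p_f (h : BraidPair lam lami deli P Pi p Q Qi f) : f * (p * f) = f := by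
  have h1 := h.f_P_f
  have h2 := h.f_Pi_f
  have h3 : f * f = f - deli • (lam • f - lami • f) := by
    nth_rw 2 [h.f_eq]
    rw [mul_sub, mul_one, mul_smul_comm, mul_sub, h.f_Q,
      mul_inv_of_mul_eq_smul h.lam_mul h.Q_Qi h.f_Q]
  rw [mul_assoc] at h1 h2
  rw [h.p_eq]
  simp only [sub_mul, mul_sub, one_mul, smul_mul_assoc, mul_smul_comm, h1, h2, h3, smul_sub]
  abel

/-- The half twist `P * Q * P` exchanges `p` and `f`. -/
theorem p_mul_twist (h : BraidPair lam lami deli P Pi p Q Qi f) :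
    p * (P * (Q * P)) = P * (Q * (P * f)) := by
  rw [h.Q_P_f, mul_mul_of_mul_eq h.p_P, mul_mul_of_mul_eq h.P_p]

theorem eq_of_mul_twist_eq (h : BraidPair lam lami deli P Pi p Q Qi f) {a b : A}
    (hab : a * (P * (Q * P)) = b * (P * (Q * P))) : a = b := by
  have hi : P * (Q * P) * (Pi * (Qi * Pi)) = 1 := by
    simp only [mul_assoc, mul_mul_of_mul_eq h.P_Pi, mul_mul_of_mul_eq h.Q_Qi, one_mul, h.P_Pi]
  calc a = a * (P * (Q * P)) * (Pi * (Qi * Pi)) := by rw [mul_assoc, hi, mul_one]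
    _ = b := by rw [hab, mul_assoc, hi, mul_one]

theorem p_Q_p (h : BraidPair lam lami deli P Pi p Q Qi f) : p * (Q * p) = lami • p := by
  apply h.eq_of_mul_twist_eq
  have hb := h.braid
  have hf := h.f_P_f
  simp only [mul_assoc] at hb hf
  calc p * (Q * p) * (P * (Q * P)) = p * (Q * (p * (P * (Q * P)))) := by simp only [mul_assoc]
    _ = p * ((Q * P * Q) * (P * f)) := by rw [h.p_mul_twist]; simp only [mul_assoc]
    _ = p * (P * (Q * P)) * (P * f) := by rw [← h.braid]; simp only [mul_assoc]
    _ = P * (Q * (P * (f * (P * f)))) := by rw [h.p_mul_twist]; simp only [mul_assoc]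
    _ = lami • p * (P * (Q * P)) := by
      rw [hf]; simp only [mul_smul_comm, smul_mul_assoc, h.p_mul_twist]

theorem p_Qi_p (h : BraidPair lam lami deli P Pi p Q Qi f) : p * (Qi * p) = lam • p := by
  apply h.eq_of_mul_twist_eq
  have hf := h.f_Pi_f
  simp only [mul_assoc] at hf
  have ht : Qi * (P * (Q * P)) = P * (Q * P) * Pi := by
    calc Qi * (P * (Q * P)) = Qi * (Q * P * Q) := by rw [← h.braid, mul_assoc]
      _ = P * Q := by simp only [mul_assoc, mul_mul_of_mul_eq h.Qi_Q, one_mul]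
      _ = P * (Q * P) * Pi := by simp only [mul_assoc, h.P_Pi, mul_one]
  calc p * (Qi * p) * (P * (Q * P)) = p * (Qi * (p * (P * (Q * P)))) := by simp only [mul_assoc]
    _ = p * (Qi * (P * (Q * P)) * f) := by rw [h.p_mul_twist]; simp only [mul_assoc]
    _ = p * (P * (Q * P)) * (Pi * f) := by rw [ht]; simp only [mul_assoc]
    _ = P * (Q * (P * (f * (Pi * f)))) := by rw [h.p_mul_twist]; simp only [mul_assoc]
    _ = lam • p * (P * (Q * P)) := by
      rw [hf]; simp only [mul_smul_comm, smul_mul_assoc, h.p_mul_twist]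

theorem Q_P_f_eq (h : BraidPair lam lami deli P Pi p Q Qi f) : Q * (P * f) = p * f := by
  calc Q * (P * f) = Q * (P * f) * (p * f) := by simp only [mul_assoc, h.f_p_f]
    _ = p * (Q * ((P * p) * f)) := by rw [h.Q_P_f]; simp only [mul_assoc]
    _ = lam • (p * (Q * p) * f) := by
      rw [h.P_p]; simp only [mul_smul_comm, smul_mul_assoc, mul_assoc]
    _ = p * f := by rw [h.p_Q_p, smul_mul_assoc, smul_smul, h.lam_mul, one_smul]

theorem f_P_Q_eq (h : BraidPair lam lami deli P Pi p Q Qi f) : f * (P * Q) = f * p := by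
  calc f * (P * Q) = f * (p * f) * (P * Q) := by rw [h.f_p_f]
    _ = f * ((p * P) * (Q * p)) := by simp only [mul_assoc, h.P_Q_p]
    _ = lam • (f * (p * (Q * p))) := by rw [h.p_P, smul_mul_assoc, mul_smul_comm]
    _ = f * p := by rw [h.p_Q_p, mul_smul_comm, smul_smul, h.lam_mul, one_smul]

theorem Q_p_f (h : BraidPair lam lami deli P Pi p Q Qi f) : Q * (p * f) = Pi * f := by
  have hc : Qi * (Pi * f) = p * (Qi * Pi) := by
    calc Qi * (Pi * f) = Qi * (Pi * (f * (P * Q))) * (Qi * Pi) := by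
          simp only [mul_assoc, mul_mul_of_mul_eq h.Q_Qi, one_mul, h.P_Pi, mul_one]
      _ = p * (Qi * Pi) := by
        rw [← h.P_Q_p]
        simp only [mul_mul_of_mul_eq h.Pi_P, mul_mul_of_mul_eq h.Qi_Q, one_mul]
  have : Qi * (Pi * f) = p * f := by
    calc Qi * (Pi * f) = Qi * (Pi * f) * (p * f) := by simp only [mul_assoc, h.f_p_f]
      _ = p * (Qi * ((Pi * p) * f)) := by rw [hc]; simp only [mul_assoc]
      _ = lami • (p * (Qi * p) * f) := by
        rw [inv_mul_of_mul_eq_smul h.lam_mul h.Pi_P h.P_p]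
        simp only [mul_smul_comm, smul_mul_assoc, mul_assoc]
      _ = p * f := by rw [h.p_Qi_p, smul_mul_assoc, smul_smul, mul_comm, h.lam_mul, one_smul]
  rw [← this, mul_mul_of_mul_eq h.Q_Qi, one_mul]

theorem f_p_Q (h : BraidPair lam lami deli P Pi p Q Qi f) : f * (p * Q) = f * Pi := by
  have hc : Pi * (Qi * p) = f * (Pi * Qi) := by
    calc Pi * (Qi * p) = Pi * (Qi * (p * (Q * P))) * (Pi * Qi) := by
          simp only [mul_assoc, mul_mul_of_mul_eq h.P_Pi, one_mul, h.Q_Qi, mul_one]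
      _ = f * (Pi * Qi) := by
        rw [← h.Q_P_f]
        simp only [mul_mul_of_mul_eq h.Pi_P, mul_mul_of_mul_eq h.Qi_Q, one_mul]
  have : f * (Pi * Qi) = f * p := by
    calc f * (Pi * Qi) = f * (p * f) * (Pi * Qi) := by rw [h.f_p_f]
      _ = f * ((p * Pi) * (Qi * p)) := by simp only [mul_assoc, hc]
      _ = lami • (f * (p * (Qi * p))) := by
        rw [mul_inv_of_mul_eq_smul h.lam_mul h.P_Pi h.p_P, smul_mul_assoc, mul_smul_comm]
      _ = f * p := by rw [h.p_Qi_p, mul_smul_comm, smul_smul, mul_comm, h.lam_mul, one_smul]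
  rw [← mul_assoc, ← this]
  simp only [mul_assoc, h.Qi_Q, mul_one]

theorem P_Q_p_Q_P (h : BraidPair lam lami deli P Pi p Q Qi f) :
    P * (Q * (p * (Q * P))) = f := by
  calc P * (Q * (p * (Q * P))) = P * (Q * p) * (Q * P) := by simp only [mul_assoc]
    _ = f * (P * Q) * (Q * P) := by rw [h.P_Q_p]
    _ = f * (p * Q) * P := by rw [h.f_P_Q_eq]; simp only [mul_assoc]
    _ = f := by rw [h.f_p_Q, mul_assoc, h.Pi_P, mul_one]

theorem Q_p_Q (h : BraidPair lam lami deli P Pi p Q Qi f) : Q * (p * Q) = Pi * (f * Pi) := by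
  rw [← h.P_Q_p_Q_P]
  simp only [mul_assoc, h.P_Pi, mul_one, mul_mul_of_mul_eq h.Pi_P, one_mul]

end BraidPair

theorem commute_of_mul_eq_one {M : Type*} [Monoid M] {z a b : M} (h : Commute z a)
    (hab : a * b = 1) (hba : b * a = 1) : Commute z b := by
  calc z * b = (b * a) * (z * b) := by rw [hba, one_mul]
    _ = b * (z * a) * b := by rw [h.eq]; simp only [mul_assoc]
    _ = b * z := by rw [mul_assoc, mul_assoc, hab, mul_one]

/-- The span of the products `a * c * b` with `a, b ∈ B` and `c ∈ W`. -/
def tripleSpan (B : Subalgebra R A) (W : Set A) : Submodule R A :=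
  Submodule.span R {w | ∃ a ∈ B, ∃ b ∈ B, ∃ c ∈ W, w = a * c * b}

section TripleSpan

variable {B B' : Subalgebra R A} {W W' : Set A}

theorem mul_mul_mem_tripleSpan {a b c : A} (ha : a ∈ B) (hb : b ∈ B) (hc : c ∈ W) :
    a * c * b ∈ tripleSpan B W :=
  Submodule.subset_span ⟨a, ha, b, hb, c, hc, rfl⟩

theorem mem_tripleSpan_of_mem {c : A} (hc : c ∈ W) : c ∈ tripleSpan B W := by
  simpa only [one_mul, mul_one] using mul_mul_mem_tripleSpan B.one_mem B.one_mem hc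

theorem tripleSpan_singleton (f : A) :
    tripleSpan B {f} = Submodule.span R {w | ∃ a ∈ B, ∃ b ∈ B, w = a * f * b} := by
  simp only [tripleSpan, Set.mem_singleton_iff, exists_eq_left]

theorem tripleSpan_mono (h : W ⊆ W') : tripleSpan B W ≤ tripleSpan B W' :=
  Submodule.span_mono fun _ ⟨a, ha, b, hb, c, hc, hw⟩ => ⟨a, ha, b, hb, c, h hc, hw⟩

theorem tripleSpan_induction {M : Submodule R A} (f : A →ₗ[R] A)
    (h : ∀ a ∈ B, ∀ b ∈ B, ∀ c ∈ W, f (a * c * b) ∈ M) {t : A} (ht : t ∈ tripleSpan B W) :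
    f t ∈ M := by
  have : tripleSpan B W ≤ M.comap f := by
    refine Submodule.span_le.2 ?_
    rintro _ ⟨a, ha, b, hb, c, hc, rfl⟩
    exact h a ha b hb c hc
  exact this ht

theorem mul_mem_tripleSpan {x t : A} (hx : x ∈ B) (ht : t ∈ tripleSpan B W) :
    x * t ∈ tripleSpan B W :=
  tripleSpan_induction (LinearMap.mulLeft R x) (fun a ha b hb c hc =>
    by simpa only [LinearMap.mulLeft_apply, mul_assoc] using
      mul_mul_mem_tripleSpan (B.mul_mem hx ha) hb hc) ht

theorem tripleSpan_mul_mem {x t : A} (hx : x ∈ B) (ht : t ∈ tripleSpan B W) :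
    t * x ∈ tripleSpan B W :=
  tripleSpan_induction (LinearMap.mulRight R x) (fun a ha b hb c hc =>
    by simpa only [LinearMap.mulRight_apply, mul_assoc] using
      mul_mul_mem_tripleSpan ha (B.mul_mem hb hx) hc) ht

theorem sandwich_mem_tripleSpan (hB : B ≤ B') {x y : A} (hx : ∀ b ∈ B, Commute x b)
    (hy : ∀ b ∈ B, Commute y b) (h : ∀ c ∈ W, x * (c * y) ∈ tripleSpan B' W') {t : A}
    (ht : t ∈ tripleSpan B W) : x * (t * y) ∈ tripleSpan B' W' := by
  refine tripleSpan_induction (LinearMap.mulLeft R x ∘ₗ LinearMap.mulRight R y)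
    (fun a ha b hb c hc => ?_) ht
  have : x * (a * c * b * y) = a * (x * (c * y)) * b := by
    rw [mul_assoc, ← (hy b hb).eq, mul_assoc a, ← mul_assoc x, (hx a ha).eq]
    simp only [mul_assoc]
  simp only [LinearMap.comp_apply, LinearMap.mulLeft_apply, LinearMap.mulRight_apply, this]
  exact tripleSpan_mul_mem (hB hb) (mul_mem_tripleSpan (hB ha) (h c hc))

end TripleSpan

theorem adjoin_mul_mem {s : Set A} {M : Submodule R A} (h : ∀ g ∈ s, ∀ t ∈ M, g * t ∈ M) {a : A}
    (ha : a ∈ Algebra.adjoin R s) : ∀ t ∈ M, a * t ∈ M := by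
  induction ha using Algebra.adjoin_induction with
  | mem g hg => exact h g hg
  | algebraMap r => intro t ht; rw [← Algebra.smul_def]; exact M.smul_mem r ht
  | add a b _ _ iha ihb => intro t ht; rw [add_mul]; exact M.add_mem (iha t ht) (ihb t ht)
  | mul a b _ _ iha ihb => intro t ht; rw [mul_assoc]; exact iha _ (ihb t ht)

theorem mul_adjoin_mem {s : Set A} {M : Submodule R A} (h : ∀ g ∈ s, ∀ t ∈ M, t * g ∈ M) {a : A}
    (ha : a ∈ Algebra.adjoin R s) : ∀ t ∈ M, t * a ∈ M := by
  induction ha using Algebra.adjoin_induction with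
  | mem g hg => exact h g hg
  | algebraMap r =>
    intro t ht; rw [← Algebra.commutes, ← Algebra.smul_def]; exact M.smul_mem r ht
  | add a b _ _ iha ihb => intro t ht; rw [mul_add]; exact M.add_mem (iha t ht) (ihb t ht)
  | mul a b _ _ iha ihb => intro t ht; rw [← mul_assoc]; exact ihb _ (iha t ht)

theorem commute_adjoin {s : Set A} {z : A} (h : ∀ g ∈ s, Commute z g) {a : A}
    (ha : a ∈ Algebra.adjoin R s) : Commute z a := by
  induction ha using Algebra.adjoin_induction with
  | mem g hg => exact h g hg
  | algebraMap r => exact (Algebra.commutes r z).symm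
  | add a b _ _ iha ihb => exact iha.add_right ihb
  | mul a b _ _ iha ihb => exact iha.mul_right ihb

/-- The Jucys-Murphy type element `X_{k-1} ⋯ X_0 Y X_0 ⋯ X_{k-1}`. -/
def jucysMurphy (X : ℕ → A) (Y : A) : ℕ → A
  | 0 => Y
  | k + 1 => X k * (jucysMurphy X Y k * X k)

/-- The subalgebra generated by `Y`, its inverse `Yi`, and `X k`, `Xi k` for `k < m`. -/
def genAlg (R : Type*) {A : Type*} [CommRing R] [Ring A] [Algebra R A] (X Xi : ℕ → A) (Y Yi : A)
    (m : ℕ) : Subalgebra R A :=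
  Algebra.adjoin R {a | a = Y ∨ a = Yi ∨ ∃ k < m, a = X k ∨ a = Xi k}

/-- The subalgebra `genAlg` on one generator less; it is the trivial one for `m = 0`. -/
def genAlgPred (R : Type*) {A : Type*} [CommRing R] [Ring A] [Algebra R A] (X Xi : ℕ → A)
    (Y Yi : A) : ℕ → Subalgebra R A
  | 0 => ⊥
  | m + 1 => genAlg R X Xi Y Yi m

/-- Representatives of the double cosets of `genAlgPred m` in `genAlg m`. -/
def cosetReps (X e : ℕ → A) (Y : A) : ℕ → Set A
  | 0 => {1, Y}
  | m + 1 => {1, X m, e m, jucysMurphy X Y (m + 1)}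

/-- The relations of the reduced Birman-Murakami-Wenzl algebra of Coxeter type B with braid
generators `X 0, …, X (N - 1)`. -/
structure ReducedBMW (N : ℕ) (lam lami del deli q0 q0i q1 : R) (X Xi e : ℕ → A) (Y Yi : A) :
    Prop where
  lam_mul : lam * lami = 1
  del_mul : del * deli = 1
  q0_mul : q0 * q0i = 1
  X_Xi : ∀ i < N, X i * Xi i = 1
  Xi_X : ∀ i < N, Xi i * X i = 1
  Y_Yi : Y * Yi = 1
  Yi_Y : Yi * Y = 1
  e_eq : ∀ i < N, e i = 1 - deli • (X i - Xi i)
  comm : ∀ i j, j + 1 < i → i < N → X i * X j = X j * X i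
  braid : ∀ i, i + 1 < N → X i * X (i + 1) * X i = X (i + 1) * X i * X (i + 1)
  X_e : ∀ i < N, X i * e i = lam • e i
  e_X : ∀ i < N, e i * X i = lam • e i
  e_X_e : ∀ i, i + 1 < N → e (i + 1) * X i * e (i + 1) = lami • e (i + 1)
  e_Xi_e : ∀ i, i + 1 < N → e (i + 1) * Xi i * e (i + 1) = lam • e (i + 1)
  X_Y_X_Y : 0 < N → X 0 * Y * X 0 * Y = Y * X 0 * Y * X 0
  Y_Y : Y * Y = q1 • Y + q0 • (1 : A)
  Y_X_Y_e : 0 < N → Y * X 0 * Y * e 0 = e 0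
  Y_comm : ∀ i, 0 < i → i < N → Y * X i = X i * Y

namespace ReducedBMW

variable {N : ℕ} {lam lami del deli q0 q0i q1 : R} {X Xi e : ℕ → A} {Y Yi : A}

theorem braidPair (h : ReducedBMW N lam lami del deli q0 q0i q1 X Xi e Y Yi) {i : ℕ}
    (hi : i + 1 < N) :
    BraidPair lam lami deli (X i) (Xi i) (e i) (X (i + 1)) (Xi (i + 1)) (e (i + 1)) where
  lam_mul := h.lam_mul
  P_Pi := h.X_Xi i (by lia)
  Pi_P := h.Xi_X i (by lia)
  Q_Qi := h.X_Xi _ hi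
  Qi_Q := h.Xi_X _ hi
  p_eq := h.e_eq i (by lia)
  f_eq := h.e_eq _ hi
  braid := h.braid i hi
  P_p := h.X_e i (by lia)
  p_P := h.e_X i (by lia)
  Q_f := h.X_e _ hi
  f_Q := h.e_X _ hi
  f_P_f := h.e_X_e i hi
  f_Pi_f := h.e_Xi_e i hi

theorem Yi_eq (h : ReducedBMW N lam lami del deli q0 q0i q1 X Xi e Y Yi) :
    Yi = q0i • (Y - q1 • (1 : A)) := by
  have hY : q0i • ((Y * Y - q1 • Y) * Yi) = Yi := by
    rw [h.Y_Y, add_sub_cancel_left, smul_mul_assoc, one_mul, smul_smul, mul_comm, h.q0_mul,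
      one_smul]
  rw [← hY, sub_mul, mul_assoc, smul_mul_assoc, h.Y_Yi, mul_one]

theorem Xi_eq_sub (h : ReducedBMW N lam lami del deli q0 q0i q1 X Xi e Y Yi) {i : ℕ}
    (hi : i < N) : Xi i = X i - del • (1 - e i) := by
  rw [h.e_eq i hi, sub_sub_cancel, smul_smul, h.del_mul, one_smul, sub_sub_cancel]

theorem X_mul_X (h : ReducedBMW N lam lami del deli q0 q0i q1 X Xi e Y Yi) {i : ℕ}
    (hi : i < N) : X i * X i = 1 + del • X i - (del * lam) • e i := by
  have hX := congrArg (X i * ·) (h.Xi_eq_sub hi)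
  simp only [h.X_Xi i hi, mul_sub, mul_smul_comm, mul_one, h.X_e i hi, smul_sub, smul_smul] at hX
  rw [hX]
  abel

theorem e_eq_X_mul_X (h : ReducedBMW N lam lami del deli q0 q0i q1 X Xi e Y Yi) {i : ℕ}
    (hi : i < N) : e i = (deli * lami) • (1 + del • X i - X i * X i) := by
  have : deli * lami * (del * lam) = 1 := by
    linear_combination deli * del * h.lam_mul + h.del_mul
  rw [h.X_mul_X hi, sub_sub_cancel, smul_smul, this, one_smul]

theorem Xi_mul_mem (h : ReducedBMW N lam lami del deli q0 q0i q1 X Xi e Y Yi) {i : ℕ}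
    (hi : i < N) {M : Submodule R A} (hM : ∀ t ∈ M, X i * t ∈ M) : ∀ t ∈ M, Xi i * t ∈ M := by
  intro t ht
  rw [h.Xi_eq_sub hi, h.e_eq_X_mul_X hi]
  simp only [sub_mul, add_mul, smul_mul_assoc, one_mul, mul_assoc]
  have h1 := hM t ht
  have h2 := hM _ h1
  exact M.sub_mem h1 (M.smul_mem _ (M.sub_mem ht (M.smul_mem _ (M.sub_mem
    (M.add_mem ht (M.smul_mem _ h1)) h2))))

theorem mul_Xi_mem (h : ReducedBMW N lam lami del deli q0 q0i q1 X Xi e Y Yi) {i : ℕ}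
    (hi : i < N) {M : Submodule R A} (hM : ∀ t ∈ M, t * X i ∈ M) : ∀ t ∈ M, t * Xi i ∈ M := by
  intro t ht
  rw [h.Xi_eq_sub hi, h.e_eq_X_mul_X hi]
  simp only [mul_sub, mul_add, mul_smul_comm, mul_one, ← mul_assoc]
  have h1 := hM t ht
  have h2 := hM _ h1
  exact M.sub_mem h1 (M.smul_mem _ (M.sub_mem ht (M.smul_mem _ (M.sub_mem
    (M.add_mem ht (M.smul_mem _ h1)) h2))))

theorem commute_e (h : ReducedBMW N lam lami del deli q0 q0i q1 X Xi e Y Yi) {i : ℕ}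
    (hi : i < N) {z : A} (hz : Commute (X i) z) : Commute (e i) z := by
  rw [h.e_eq i hi]
  exact (Commute.one_left z).sub_left ((hz.sub_left
    (commute_of_mul_eq_one hz.symm (h.X_Xi i hi) (h.Xi_X i hi)).symm).smul_left _)

theorem commute_genAlg (h : ReducedBMW N lam lami del deli q0 q0i q1 X Xi e Y Yi) {m : ℕ}
    (hm : m ≤ N) {z : A} (hY : Commute z Y) (hX : ∀ k < m, Commute z (X k)) {b : A}
    (hb : b ∈ genAlg R X Xi Y Yi m) : Commute z b := by
  refine commute_adjoin ?_ hb
  rintro g (rfl | rfl | ⟨k, hk, rfl | rfl⟩)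
  · exact hY
  · exact commute_of_mul_eq_one hY h.Y_Yi h.Yi_Y
  · exact hX k hk
  · exact commute_of_mul_eq_one (hX k hk) (h.X_Xi k (by lia)) (h.Xi_X k (by lia))

theorem Y_mem {m : ℕ} : Y ∈ genAlg R X Xi Y Yi m :=
  Algebra.subset_adjoin (Or.inl rfl)

theorem Yi_mem {m : ℕ} : Yi ∈ genAlg R X Xi Y Yi m :=
  Algebra.subset_adjoin (Or.inr (Or.inl rfl))

theorem X_mem {k m : ℕ} (hk : k < m) : X k ∈ genAlg R X Xi Y Yi m :=
  Algebra.subset_adjoin (Or.inr (Or.inr ⟨k, hk, Or.inl rfl⟩))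

theorem Xi_mem {k m : ℕ} (hk : k < m) : Xi k ∈ genAlg R X Xi Y Yi m :=
  Algebra.subset_adjoin (Or.inr (Or.inr ⟨k, hk, Or.inr rfl⟩))

theorem e_mem (h : ReducedBMW N lam lami del deli q0 q0i q1 X Xi e Y Yi) {k m : ℕ} (hk : k < m)
    (hm : m ≤ N) : e k ∈ genAlg R X Xi Y Yi m := by
  rw [h.e_eq k (by lia)]
  exact sub_mem (one_mem _) (Subalgebra.smul_mem _ (sub_mem (X_mem hk) (Xi_mem hk)) _)

theorem jucysMurphy_mem {k m : ℕ} (hk : k ≤ m) : jucysMurphy X Y k ∈ genAlg R X Xi Y Yi m := by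
  induction k with
  | zero => exact Y_mem
  | succ k ih => exact mul_mem (X_mem hk) (mul_mem (ih (by lia)) (X_mem hk))

theorem jucysMurphy_inv_mem {k m : ℕ} (hk : k ≤ m) :
    jucysMurphy Xi Yi k ∈ genAlg R X Xi Y Yi m := by
  induction k with
  | zero => exact Yi_mem
  | succ k ih => exact mul_mem (Xi_mem hk) (mul_mem (ih (by lia)) (Xi_mem hk))

theorem jucysMurphy_inv_mul (h : ReducedBMW N lam lami del deli q0 q0i q1 X Xi e Y Yi) {k : ℕ}
    (hk : k ≤ N) : jucysMurphy Xi Yi k * jucysMurphy X Y k = 1 := by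
  induction k with
  | zero => exact h.Yi_Y
  | succ k ih =>
    simp only [jucysMurphy, mul_assoc, mul_mul_of_mul_eq (h.Xi_X k hk),
      mul_mul_of_mul_eq (ih (by lia)), one_mul, h.Xi_X k hk]

theorem jucysMurphy_mul_inv (h : ReducedBMW N lam lami del deli q0 q0i q1 X Xi e Y Yi) {k : ℕ}
    (hk : k ≤ N) : jucysMurphy X Y k * jucysMurphy Xi Yi k = 1 := by
  induction k with
  | zero => exact h.Y_Yi
  | succ k ih =>
    simp only [jucysMurphy, mul_assoc, mul_mul_of_mul_eq (h.X_Xi k hk),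
      mul_mul_of_mul_eq (ih (by lia)), one_mul, h.X_Xi k hk]

theorem commute_X_genAlg (h : ReducedBMW N lam lami del deli q0 q0i q1 X Xi e Y Yi) {m j : ℕ}
    (hmj : m < j) (hj : j < N) {b : A} (hb : b ∈ genAlg R X Xi Y Yi m) : Commute (X j) b :=
  h.commute_genAlg (by lia) (h.Y_comm j (by lia) hj).symm (fun k hk => h.comm j k (by lia) hj) hb

theorem commute_X_genAlgPred (h : ReducedBMW N lam lami del deli q0 q0i q1 X Xi e Y Yi) {m : ℕ}
    (hm : m < N) {b : A} (hb : b ∈ genAlgPred R X Xi Y Yi m) : Commute (X m) b := by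
  cases m with
  | zero =>
    obtain ⟨r, rfl⟩ := Algebra.mem_bot.1 hb
    exact (Algebra.commutes r _).symm
  | succ m => exact h.commute_X_genAlg (Nat.lt_succ_self m) hm hb

theorem genAlgPred_le (m : ℕ) : genAlgPred R X Xi Y Yi m ≤ genAlg R X Xi Y Yi m := by
  cases m with
  | zero => exact bot_le
  | succ m =>
    refine Algebra.adjoin_mono ?_
    rintro g (hg | hg | ⟨k, hk, hg⟩)
    exacts [Or.inl hg, Or.inr (Or.inl hg), Or.inr (Or.inr ⟨k, by lia, hg⟩)]

theorem commute_jucysMurphy_Y (h : ReducedBMW N lam lami del deli q0 q0i q1 X Xi e Y Yi) {m : ℕ}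
    (hm : m < N) : Commute (jucysMurphy X Y (m + 1)) Y := by
  induction m with
  | zero =>
    have := h.X_Y_X_Y hm
    simp only [mul_assoc] at this
    simpa only [jucysMurphy, Commute, SemiconjBy, mul_assoc] using this
  | succ m ih =>
    have hX : Commute (X (m + 1)) Y := (h.Y_comm (m + 1) (by lia) hm).symm
    exact hX.mul_left ((ih (by lia)).mul_left hX)

theorem commute_jucysMurphy_X (h : ReducedBMW N lam lami del deli q0 q0i q1 X Xi e Y Yi)
    {m k : ℕ} (hk : k < m) (hm : m < N) : Commute (jucysMurphy X Y (m + 1)) (X k) := by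
  induction m with
  | zero => lia
  | succ m ih =>
    rcases Nat.lt_succ_iff_lt_or_eq.1 hk with hk | rfl
    · have hX : Commute (X (m + 1)) (X k) := h.comm _ _ (by lia) hm
      exact hX.mul_left ((ih hk (by lia)).mul_left hX)
    · have hJ : X (k + 1) * jucysMurphy X Y k = jucysMurphy X Y k * X (k + 1) :=
        h.commute_X_genAlg (Nat.lt_succ_self k) hm (jucysMurphy_mem (Xi := Xi) (Yi := Yi) le_rfl)
      have hb := h.braid k hm
      simp only [mul_assoc] at hb
      calc X (k + 1) * ((X k * (jucysMurphy X Y k * X k)) * X (k + 1)) * X k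
          = X (k + 1) * (X k * (jucysMurphy X Y k * (X k * (X (k + 1) * X k)))) := by
            simp only [mul_assoc]
        _ = X (k + 1) * (X k * ((X (k + 1) * jucysMurphy X Y k) * (X k * X (k + 1)))) := by
            rw [hb, hJ]; simp only [mul_assoc]
        _ = X k * X (k + 1) * X k * (jucysMurphy X Y k * (X k * X (k + 1))) := by
            rw [h.braid k hm]; simp only [mul_assoc]
        _ = X k * (X (k + 1) * ((X k * (jucysMurphy X Y k * X k)) * X (k + 1))) := by
            simp only [mul_assoc]

theorem commute_jucysMurphy (h : ReducedBMW N lam lami del deli q0 q0i q1 X Xi e Y Yi) {m : ℕ}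
    (hm : m < N) {b : A} (hb : b ∈ genAlg R X Xi Y Yi m) : Commute (jucysMurphy X Y (m + 1)) b :=
  h.commute_genAlg hm.le (h.commute_jucysMurphy_Y hm)
    (fun _ hk => h.commute_jucysMurphy_X hk hm) hb

theorem jucysMurphy_X_jucysMurphy_e (h : ReducedBMW N lam lami del deli q0 q0i q1 X Xi e Y Yi)
    {k : ℕ} (hk : k < N) :
    jucysMurphy X Y k * (X k * (jucysMurphy X Y k * e k)) = e k := by
  induction k with
  | zero => simpa only [jucysMurphy, mul_assoc] using h.Y_X_Y_e hk
  | succ k ih =>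
    have hp := h.braidPair hk
    have ih := ih (by lia)
    have hc : Commute (X (k + 1)) (jucysMurphy X Y k) :=
      h.commute_X_genAlg (Nat.lt_succ_self k) hk (jucysMurphy_mem (Xi := Xi) (Yi := Yi) le_rfl)
    have hb := h.braid k hk
    simp only [jucysMurphy]
    generalize jucysMurphy X Y k = J at *
    generalize X (k + 1) = Q, X k = P, e (k + 1) = f, e k = p, Xi k = Pi, Xi (k + 1) = Qi at *
    calc P * (J * P) * (Q * (P * (J * P) * f))
        = P * (J * (P * Q * P * (J * (P * f)))) := by simp only [mul_assoc]
      _ = P * ((J * Q) * (P * ((Q * J) * (P * f)))) := by rw [hb]; simp only [mul_assoc]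
      _ = P * (Q * (J * (P * (J * (Q * (P * f)))))) := by
        rw [← hc.eq]; simp only [mul_assoc, mul_mul_of_mul_eq hc.eq]
      _ = P * (Q * ((J * (P * (J * p))) * (Q * P))) := by rw [hp.Q_P_f]; simp only [mul_assoc]
      _ = f := by rw [ih, hp.P_Q_p_Q_P]

theorem e_jucysMurphy_X_jucysMurphy (h : ReducedBMW N lam lami del deli q0 q0i q1 X Xi e Y Yi)
    {k : ℕ} (hk : k < N) :
    e k * (jucysMurphy X Y k * (X k * jucysMurphy X Y k)) = e k := by
  induction k with
  | zero =>
    have hX := h.X_Y_X_Y hk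
    simp only [mul_assoc] at hX
    have hc : Commute (X 0) (Y * (X 0 * Y)) := by
      simpa only [Commute, SemiconjBy, mul_assoc] using hX
    rw [jucysMurphy, (h.commute_e hk hc).eq]
    simpa only [mul_assoc] using h.Y_X_Y_e hk
  | succ k ih =>
    have hp := h.braidPair hk
    have ih := ih (by lia)
    have hc : Commute (X (k + 1)) (jucysMurphy X Y k) :=
      h.commute_X_genAlg (Nat.lt_succ_self k) hk (jucysMurphy_mem (Xi := Xi) (Yi := Yi) le_rfl)
    have hb := h.braid k hk
    simp only [jucysMurphy]
    generalize jucysMurphy X Y k = J at *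
    generalize X (k + 1) = Q, X k = P, e (k + 1) = f, e k = p, Xi k = Pi, Xi (k + 1) = Qi at *
    calc f * (P * (J * P) * (Q * (P * (J * P))))
        = f * (P * (J * (P * Q * P * (J * P)))) := by simp only [mul_assoc]
      _ = f * (P * ((J * Q) * (P * ((Q * J) * P)))) := by rw [hb]; simp only [mul_assoc]
      _ = f * (P * Q) * (J * (P * (J * (Q * P)))) := by
        rw [← hc.eq]; simp only [mul_assoc, mul_mul_of_mul_eq hc.eq]
      _ = P * (Q * (p * (J * (P * J)) * (Q * P))) := by rw [← hp.P_Q_p]; simp only [mul_assoc]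
      _ = f := by rw [ih, hp.P_Q_p_Q_P]

theorem X_jucysMurphy_e (h : ReducedBMW N lam lami del deli q0 q0i q1 X Xi e Y Yi) {k : ℕ}
    (hk : k < N) : X k * (jucysMurphy X Y k * e k) = jucysMurphy Xi Yi k * e k := by
  conv_rhs => rw [← h.jucysMurphy_X_jucysMurphy_e hk,
    mul_mul_of_mul_eq (h.jucysMurphy_inv_mul hk.le), one_mul]

theorem e_jucysMurphy_X (h : ReducedBMW N lam lami del deli q0 q0i q1 X Xi e Y Yi) {k : ℕ}
    (hk : k < N) : e k * (jucysMurphy X Y k * X k) = e k * jucysMurphy Xi Yi k := by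
  conv_rhs => rw [← h.e_jucysMurphy_X_jucysMurphy hk]
  simp only [mul_assoc, h.jucysMurphy_mul_inv hk.le, mul_one]

theorem X_cosetReps_e_mem (h : ReducedBMW N lam lami del deli q0 q0i q1 X Xi e Y Yi) {m : ℕ}
    (hm : m < N) {c : A} (hc : c ∈ cosetReps X e Y m) :
    X m * (c * e m) ∈ tripleSpan (genAlg R X Xi Y Yi m) {e m} := by
  have hmem : e m ∈ tripleSpan (genAlg R X Xi Y Yi m) {e m} :=
    mem_tripleSpan_of_mem (Set.mem_singleton _)
  have h1 : X m * (1 * e m) ∈ tripleSpan (genAlg R X Xi Y Yi m) {e m} := by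
    rw [one_mul, h.X_e m hm]
    exact Submodule.smul_mem _ _ hmem
  have hJ : X m * (jucysMurphy X Y m * e m) ∈ tripleSpan (genAlg R X Xi Y Yi m) {e m} := by
    rw [h.X_jucysMurphy_e hm]
    exact mul_mem_tripleSpan (jucysMurphy_inv_mem le_rfl) hmem
  cases m with
  | zero =>
    rcases hc with rfl | rfl
    exacts [h1, hJ]
  | succ m =>
    have hp := h.braidPair hm
    rcases hc with rfl | rfl | rfl | rfl
    · exact h1
    · rw [hp.Q_P_f_eq]
      exact mul_mem_tripleSpan (h.e_mem (Nat.lt_succ_self m) hm.le) hmem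
    · rw [hp.Q_p_f]
      exact mul_mem_tripleSpan (Xi_mem (Nat.lt_succ_self m)) hmem
    · exact hJ

theorem e_cosetReps_X_mem (h : ReducedBMW N lam lami del deli q0 q0i q1 X Xi e Y Yi) {m : ℕ}
    (hm : m < N) {c : A} (hc : c ∈ cosetReps X e Y m) :
    e m * (c * X m) ∈ tripleSpan (genAlg R X Xi Y Yi m) {e m} := by
  have hmem : e m ∈ tripleSpan (genAlg R X Xi Y Yi m) {e m} :=
    mem_tripleSpan_of_mem (Set.mem_singleton _)
  have h1 : e m * (1 * X m) ∈ tripleSpan (genAlg R X Xi Y Yi m) {e m} := by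
    rw [one_mul, h.e_X m hm]
    exact Submodule.smul_mem _ _ hmem
  have hJ : e m * (jucysMurphy X Y m * X m) ∈ tripleSpan (genAlg R X Xi Y Yi m) {e m} := by
    rw [h.e_jucysMurphy_X hm]
    exact tripleSpan_mul_mem (jucysMurphy_inv_mem le_rfl) hmem
  cases m with
  | zero =>
    rcases hc with rfl | rfl
    exacts [h1, hJ]
  | succ m =>
    have hp := h.braidPair hm
    rcases hc with rfl | rfl | rfl | rfl
    · exact h1
    · rw [hp.f_P_Q_eq]
      exact tripleSpan_mul_mem (h.e_mem (Nat.lt_succ_self m) hm.le) hmem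
    · rw [hp.f_p_Q]
      exact tripleSpan_mul_mem (Xi_mem (Nat.lt_succ_self m)) hmem
    · exact hJ

theorem X_cosetReps_X_mem (h : ReducedBMW N lam lami del deli q0 q0i q1 X Xi e Y Yi) {m : ℕ}
    (hm : m < N) {c : A} (hc : c ∈ cosetReps X e Y m) :
    X m * (c * X m) ∈ tripleSpan (genAlg R X Xi Y Yi m) (cosetReps X e Y (m + 1)) := by
  have m1 : 1 ∈ tripleSpan (genAlg R X Xi Y Yi m) (cosetReps X e Y (m + 1)) :=
    mem_tripleSpan_of_mem (Or.inl rfl)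
  have mX : X m ∈ tripleSpan (genAlg R X Xi Y Yi m) (cosetReps X e Y (m + 1)) :=
    mem_tripleSpan_of_mem (Or.inr (Or.inl rfl))
  have me : e m ∈ tripleSpan (genAlg R X Xi Y Yi m) (cosetReps X e Y (m + 1)) :=
    mem_tripleSpan_of_mem (Or.inr (Or.inr (Or.inl rfl)))
  have mJ : X m * (jucysMurphy X Y m * X m) ∈
      tripleSpan (genAlg R X Xi Y Yi m) (cosetReps X e Y (m + 1)) :=
    mem_tripleSpan_of_mem (Or.inr (Or.inr (Or.inr rfl)))
  have h1 : X m * (1 * X m) ∈ tripleSpan (genAlg R X Xi Y Yi m) (cosetReps X e Y (m + 1)) := by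
    rw [one_mul, h.X_mul_X hm]
    exact Submodule.sub_mem _ (Submodule.add_mem _ m1 (Submodule.smul_mem _ _ mX))
      (Submodule.smul_mem _ _ me)
  cases m with
  | zero =>
    rcases hc with rfl | rfl
    exacts [h1, mJ]
  | succ m =>
    have hp := h.braidPair hm
    have hX : X m ∈ genAlg R X Xi Y Yi (m + 1) := X_mem (Nat.lt_succ_self m)
    have hXi : Xi m ∈ genAlg R X Xi Y Yi (m + 1) := Xi_mem (Nat.lt_succ_self m)
    rcases hc with rfl | rfl | rfl | rfl
    · exact h1
    · rw [← mul_assoc, ← hp.braid]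
      exact tripleSpan_mul_mem hX (mul_mem_tripleSpan hX mX)
    · rw [hp.Q_p_Q]
      exact mul_mem_tripleSpan hXi (tripleSpan_mul_mem hXi me)
    · exact mJ

/-- Every element of `genAlg m` is a combination of products `a * c * b` with
`a, b ∈ genAlgPred m` and `c` one of the double coset representatives. -/
theorem mem_tripleSpan_cosetReps (h : ReducedBMW N lam lami del deli q0 q0i q1 X Xi e Y Yi)
    {m : ℕ} (hm : m ≤ N) {a : A} (ha : a ∈ genAlg R X Xi Y Yi m) :
    a ∈ tripleSpan (genAlgPred R X Xi Y Yi m) (cosetReps X e Y m) := by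
  induction m generalizing a with
  | zero =>
    have m1 : (1 : A) ∈ tripleSpan (⊥ : Subalgebra R A) {1, Y} :=
      mem_tripleSpan_of_mem (Or.inl rfl)
    have mY : Y ∈ tripleSpan (⊥ : Subalgebra R A) {1, Y} :=
      mem_tripleSpan_of_mem (Or.inr rfl)
    have hbot : ∀ z : A, ∀ b ∈ (⊥ : Subalgebra R A), Commute z b := by
      intro z b hb
      obtain ⟨r, rfl⟩ := Algebra.mem_bot.1 hb
      exact (Algebra.commutes r _).symm
    have hY : ∀ t ∈ tripleSpan (⊥ : Subalgebra R A) {1, Y},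
        Y * t ∈ tripleSpan (⊥ : Subalgebra R A) {1, Y} := by
      intro t ht
      rw [← mul_one t]
      refine sandwich_mem_tripleSpan le_rfl (hbot Y) (hbot 1) ?_ ht
      rintro c (rfl | rfl)
      · simpa only [mul_one] using mY
      · rw [mul_one, h.Y_Y]
        exact Submodule.add_mem _ (Submodule.smul_mem _ _ mY) (Submodule.smul_mem _ _ m1)
    rw [← mul_one a]
    refine adjoin_mul_mem ?_ ha 1 m1
    rintro g (rfl | rfl | ⟨k, hk, -⟩) t ht
    · exact hY t ht
    · rw [h.Yi_eq, smul_mul_assoc, sub_mul, smul_mul_assoc, one_mul]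
      exact Submodule.smul_mem _ _ (Submodule.sub_mem _ (hY t ht) (Submodule.smul_mem _ _ ht))
    · lia
  | succ m ih =>
    have hX : ∀ t ∈ tripleSpan (genAlg R X Xi Y Yi m) (cosetReps X e Y (m + 1)),
        X m * t ∈ tripleSpan (genAlg R X Xi Y Yi m) (cosetReps X e Y (m + 1)) := by
      intro t ht
      refine tripleSpan_induction (LinearMap.mulLeft R (X m)) (fun a ha b hb c hc => ?_) ht
      rw [LinearMap.mulLeft_apply, ← mul_assoc]
      refine tripleSpan_mul_mem hb ?_
      have hcomm : ∀ b ∈ genAlgPred R X Xi Y Yi m, Commute (X m) b :=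
        fun b hb => h.commute_X_genAlgPred hm hb
      have hcomm' : ∀ b ∈ genAlgPred R X Xi Y Yi m, Commute (e m) b :=
        fun b hb => h.commute_e hm (hcomm b hb)
      have hle : tripleSpan (genAlg R X Xi Y Yi m) {e m} ≤
          tripleSpan (genAlg R X Xi Y Yi m) (cosetReps X e Y (m + 1)) :=
        tripleSpan_mono (Set.singleton_subset_iff.2 (Or.inr (Or.inr (Or.inl rfl))))
      have mX : X m ∈ tripleSpan (genAlg R X Xi Y Yi m) (cosetReps X e Y (m + 1)) :=
        mem_tripleSpan_of_mem (Or.inr (Or.inl rfl))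
      have mJ : jucysMurphy X Y (m + 1) ∈
          tripleSpan (genAlg R X Xi Y Yi m) (cosetReps X e Y (m + 1)) :=
        mem_tripleSpan_of_mem (Or.inr (Or.inr (Or.inr rfl)))
      have hJm : jucysMurphy X Y m ∈ genAlg R X Xi Y Yi m := jucysMurphy_mem le_rfl
      rcases hc with rfl | rfl | rfl | rfl
      · rw [mul_one]
        exact tripleSpan_mul_mem ha mX
      · exact sandwich_mem_tripleSpan (genAlgPred_le m) hcomm hcomm
          (fun c hc => h.X_cosetReps_X_mem hm hc) (ih (by lia) ha)
      · exact hle (sandwich_mem_tripleSpan (genAlgPred_le m) hcomm hcomm'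
          (fun c hc => h.X_cosetReps_e_mem hm hc) (ih (by lia) ha))
      · rw [← (h.commute_jucysMurphy hm ha).eq, ← mul_assoc]
        refine tripleSpan_mul_mem ha ?_
        have hsq : X m * jucysMurphy X Y (m + 1) = jucysMurphy X Y m * X m +
            del • jucysMurphy X Y (m + 1) - (del * lam) • (e m * (jucysMurphy X Y m * X m)) := by
          simp only [jucysMurphy]
          rw [← mul_assoc, h.X_mul_X hm, sub_mul, add_mul, one_mul, smul_mul_assoc, smul_mul_assoc]
        rw [hsq, h.e_jucysMurphy_X hm]
        exact Submodule.sub_mem _ (Submodule.add_mem _ (mul_mem_tripleSpan hJm mX)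
          (Submodule.smul_mem _ _ mJ)) (Submodule.smul_mem _ _ (hle (tripleSpan_mul_mem
            (jucysMurphy_inv_mem le_rfl) (mem_tripleSpan_of_mem (Set.mem_singleton _)))))
    rw [← mul_one a]
    refine adjoin_mul_mem ?_ ha 1 (mem_tripleSpan_of_mem (Or.inl rfl))
    rintro g (rfl | rfl | ⟨k, hk, hg⟩) t ht
    · exact mul_mem_tripleSpan Y_mem ht
    · exact mul_mem_tripleSpan Yi_mem ht
    · rcases Nat.lt_succ_iff_lt_or_eq.1 hk with hk | rfl
      · rcases hg with rfl | rfl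
        · exact mul_mem_tripleSpan (X_mem hk) ht
        · exact mul_mem_tripleSpan (Xi_mem hk) ht
      · rcases hg with rfl | rfl
        · exact hX t ht
        · exact h.Xi_mul_mem hm hX t ht

theorem mul_mem_tripleSpan_e (h : ReducedBMW N lam lami del deli q0 q0i q1 X Xi e Y Yi) {m : ℕ}
    (hm : m < N) {a t : A} (ha : a ∈ genAlg R X Xi Y Yi (m + 1))
    (ht : t ∈ tripleSpan (genAlg R X Xi Y Yi m) {e m}) :
    a * t ∈ tripleSpan (genAlg R X Xi Y Yi m) {e m} := by
  have hX : ∀ t ∈ tripleSpan (genAlg R X Xi Y Yi m) {e m},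
      X m * t ∈ tripleSpan (genAlg R X Xi Y Yi m) {e m} := by
    intro t ht
    refine tripleSpan_induction (LinearMap.mulLeft R (X m)) (fun a ha b hb c hc => ?_) ht
    obtain rfl := Set.mem_singleton_iff.1 hc
    rw [LinearMap.mulLeft_apply, ← mul_assoc]
    exact tripleSpan_mul_mem hb (sandwich_mem_tripleSpan (genAlgPred_le m)
      (fun b hb => h.commute_X_genAlgPred hm hb)
      (fun b hb => h.commute_e hm (h.commute_X_genAlgPred hm hb))
      (fun c hc => h.X_cosetReps_e_mem hm hc) (h.mem_tripleSpan_cosetReps hm.le ha))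
  refine adjoin_mul_mem ?_ ha t ht
  rintro g (rfl | rfl | ⟨k, hk, hg⟩) t ht
  · exact mul_mem_tripleSpan Y_mem ht
  · exact mul_mem_tripleSpan Yi_mem ht
  · rcases Nat.lt_succ_iff_lt_or_eq.1 hk with hk | rfl
    · rcases hg with rfl | rfl
      · exact mul_mem_tripleSpan (X_mem hk) ht
      · exact mul_mem_tripleSpan (Xi_mem hk) ht
    · rcases hg with rfl | rfl
      · exact hX t ht
      · exact h.Xi_mul_mem hm hX t ht

theorem tripleSpan_e_mul_mem (h : ReducedBMW N lam lami del deli q0 q0i q1 X Xi e Y Yi) {m : ℕ}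
    (hm : m < N) {a t : A} (ha : a ∈ genAlg R X Xi Y Yi (m + 1))
    (ht : t ∈ tripleSpan (genAlg R X Xi Y Yi m) {e m}) :
    t * a ∈ tripleSpan (genAlg R X Xi Y Yi m) {e m} := by
  have hX : ∀ t ∈ tripleSpan (genAlg R X Xi Y Yi m) {e m},
      t * X m ∈ tripleSpan (genAlg R X Xi Y Yi m) {e m} := by
    intro t ht
    refine tripleSpan_induction (LinearMap.mulRight R (X m)) (fun a ha b hb c hc => ?_) ht
    obtain rfl := Set.mem_singleton_iff.1 hc
    rw [LinearMap.mulRight_apply, mul_assoc, mul_assoc]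
    exact mul_mem_tripleSpan ha (sandwich_mem_tripleSpan (genAlgPred_le m)
      (fun b hb => h.commute_e hm (h.commute_X_genAlgPred hm hb))
      (fun b hb => h.commute_X_genAlgPred hm hb)
      (fun c hc => h.e_cosetReps_X_mem hm hc) (h.mem_tripleSpan_cosetReps hm.le hb))
  refine mul_adjoin_mem ?_ ha t ht
  rintro g (rfl | rfl | ⟨k, hk, hg⟩) t ht
  · exact tripleSpan_mul_mem Y_mem ht
  · exact tripleSpan_mul_mem Yi_mem ht
  · rcases Nat.lt_succ_iff_lt_or_eq.1 hk with hk | rfl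
    · rcases hg with rfl | rfl
      · exact tripleSpan_mul_mem (X_mem hk) ht
      · exact tripleSpan_mul_mem (Xi_mem hk) ht
    · rcases hg with rfl | rfl
      · exact hX t ht
      · exact h.mul_Xi_mem hm hX t ht

/-- If `genAlg (m + 1)` is the whole algebra, the two-sided ideal generated by `e m` is spanned by
the products `a * e m * b` with `a, b ∈ genAlg m`. -/
theorem mem_span_e_iff (h : ReducedBMW N lam lami del deli q0 q0i q1 X Xi e Y Yi) {m : ℕ}
    (hm : m < N) (htop : ∀ z, z ∈ genAlg R X Xi Y Yi (m + 1)) (z : A) :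
    z ∈ TwoSidedIdeal.span {e m} ↔ z ∈ tripleSpan (genAlg R X Xi Y Yi m) {e m} := by
  constructor
  · intro hz
    let I : TwoSidedIdeal A :=
      .mk' (tripleSpan (genAlg R X Xi Y Yi m) {e m} : Set A)
        (Submodule.zero_mem _) (Submodule.add_mem _) (Submodule.neg_mem _)
        (fun {x y} hy => h.mul_mem_tripleSpan_e hm (htop x) hy)
        (fun {x y} hx => h.tripleSpan_e_mul_mem hm (htop y) hx)
    have hI : z ∈ I := by
      refine TwoSidedIdeal.mem_span_iff.1 hz I (Set.singleton_subset_iff.2 ?_)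
      exact (TwoSidedIdeal.mem_mk' _ _ _ _ _ _ _).2 (mem_tripleSpan_of_mem (Set.mem_singleton _))
    exact (TwoSidedIdeal.mem_mk' _ _ _ _ _ _ _).1 hI
  · intro hz
    induction hz using Submodule.span_induction with
    | mem w hw =>
      obtain ⟨a, -, b, -, c, hc, rfl⟩ := hw
      exact TwoSidedIdeal.mul_mem_right _ _ _ (TwoSidedIdeal.mul_mem_left _ _ _
        (TwoSidedIdeal.subset_span hc))
    | zero => exact zero_mem _
    | add x y _ _ hx hy => exact add_mem hx hy
    | smul r x _ hx =>
      rw [Algebra.smul_def]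
      exact TwoSidedIdeal.mul_mem_left _ _ _ hx

end ReducedBMW

end Abstract

section Presentation

variable {R : Type} [CommRing R] {lam lami deli q0 q1 A : R} {n : ℕ}

local notation "π" => mk R lam lami deli q0 q1 A n

theorem mk_rel {a b : FreeAlgebra R (Gen n)} (h : Rel R lam lami deli q0 q1 A n a b) :
    π a = π b :=
  RingQuot.mkAlgHom_rel R h

theorem XX_succ {k : ℕ} (hk : k < n - 1) :
    XX R lam lami deli q0 q1 A n (k + 1) = π (fX R ⟨k, hk⟩) :=
  dif_pos hk

theorem XXi_succ {k : ℕ} (hk : k < n - 1) :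
    XXi R lam lami deli q0 q1 A n (k + 1) = π (fXinv R ⟨k, hk⟩) :=
  dif_pos hk

theorem YY_eq (hn : 0 < n) : YY R lam lami deli q0 q1 A n = π (fY R hn) :=
  dif_pos hn

theorem YYi_eq (hn : 0 < n) : YYi R lam lami deli q0 q1 A n = π (fYinv R hn) :=
  dif_pos hn

theorem ee_succ {k : ℕ} (hk : k < n - 1) :
    ee R lam lami deli q0 q1 A n (k + 1) = π (fe R deli ⟨k, hk⟩) := by
  rw [ee, fe, XX_succ hk, XXi_succ hk, map_sub, map_one, map_smul, map_sub]

theorem reducedBMW {del q0i : R} (hlam : lam * lami = 1) (hdel : del * deli = 1)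
    (hq0 : q0 * q0i = 1) (hn : 0 < n) :
    ReducedBMW (n - 1) lam lami del deli q0 q0i q1
      (fun k => XX R lam lami deli q0 q1 A n (k + 1))
      (fun k => XXi R lam lami deli q0 q1 A n (k + 1))
      (fun k => ee R lam lami deli q0 q1 A n (k + 1))
      (YY R lam lami deli q0 q1 A n) (YYi R lam lami deli q0 q1 A n) where
  lam_mul := hlam
  del_mul := hdel
  q0_mul := hq0
  X_Xi i hi := by
    simpa only [XX_succ hi, XXi_succ hi, map_mul, map_one] using mk_rel (Rel.XXinv ⟨i, hi⟩)
  Xi_X i hi := by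
    simpa only [XX_succ hi, XXi_succ hi, map_mul, map_one] using mk_rel (Rel.XinvX ⟨i, hi⟩)
  Y_Yi := by simpa only [YY_eq hn, YYi_eq hn, map_mul, map_one] using mk_rel (Rel.YYinv hn)
  Yi_Y := by simpa only [YY_eq hn, YYi_eq hn, map_mul, map_one] using mk_rel (Rel.YinvY hn)
  e_eq _ _ := rfl
  comm i j hji hi := by
    have hj : j < n - 1 := by lia
    simpa only [XX_succ hi, XX_succ hj, map_mul] using mk_rel (Rel.comm ⟨i, hi⟩ ⟨j, hj⟩ hji)
  braid i hi := by
    have hi' : i < n - 1 := by lia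
    simpa only [XX_succ hi, XX_succ hi', map_mul] using
      mk_rel (Rel.braid ⟨i, hi'⟩ ⟨i + 1, hi⟩ rfl)
  X_e i hi := by
    simpa only [XX_succ hi, ee_succ hi, map_mul, map_smul] using mk_rel (Rel.Xe ⟨i, hi⟩)
  e_X i hi := by
    simpa only [XX_succ hi, ee_succ hi, map_mul, map_smul] using mk_rel (Rel.eX ⟨i, hi⟩)
  e_X_e i hi := by
    have hi' : i < n - 1 := by lia
    simpa only [XX_succ hi', ee_succ hi, map_mul, map_smul] using
      mk_rel (Rel.eXe ⟨i + 1, hi⟩ ⟨i, hi'⟩ rfl)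
  e_Xi_e i hi := by
    have hi' : i < n - 1 := by lia
    simpa only [XXi_succ hi', ee_succ hi, map_mul, map_smul] using
      mk_rel (Rel.eXinve ⟨i + 1, hi⟩ ⟨i, hi'⟩ rfl)
  X_Y_X_Y h0 := by
    simpa only [XX_succ h0, YY_eq hn, map_mul] using mk_rel (Rel.bYXYX hn ⟨0, h0⟩ rfl)
  Y_Y := by
    simpa only [YY_eq hn, map_mul, map_add, map_smul, map_one] using mk_rel (Rel.Ysq hn)
  Y_X_Y_e h0 := by
    simpa only [XX_succ h0, YY_eq hn, ee_succ h0, map_mul] using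
      mk_rel (Rel.YXYe hn ⟨0, h0⟩ rfl)
  Y_comm i h0 hi := by
    simpa only [XX_succ hi, YY_eq hn, map_mul] using mk_rel (Rel.Ycomm hn ⟨i, hi⟩ h0)

theorem sub_eq_genAlg (m : ℕ) :
    sub R lam lami deli q0 q1 A n m = genAlg R
      (fun k => XX R lam lami deli q0 q1 A n (k + 1))
      (fun k => XXi R lam lami deli q0 q1 A n (k + 1))
      (YY R lam lami deli q0 q1 A n) (YYi R lam lami deli q0 q1 A n) m := by
  rw [sub, genAlg]
  congr 1
  ext a
  refine or_congr_right (or_congr_right ⟨?_, ?_⟩)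
  · rintro ⟨i, hi, him, ha⟩
    refine ⟨i - 1, by lia, ?_⟩
    simpa only [Nat.sub_add_cancel hi] using ha
  · rintro ⟨k, hk, ha⟩
    exact ⟨k + 1, by lia, hk, ha⟩

theorem mem_sub_top (z : BB R lam lami deli q0 q1 A n) :
    z ∈ sub R lam lami deli q0 q1 A n (n - 1) := by
  obtain ⟨a, rfl⟩ := RingQuot.mkAlgHom_surjective R (Rel R lam lami deli q0 q1 A n) z
  change π a ∈ _
  induction a using FreeAlgebra.induction with
  | grade0 r => rw [AlgHom.commutes]; exact Subalgebra.algebraMap_mem _ r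
  | grade1 g =>
    refine Algebra.subset_adjoin ?_
    cases g with
    | X i => exact Or.inr (Or.inr ⟨i + 1, by lia, i.2, Or.inl (XX_succ i.2).symm⟩)
    | Xinv i => exact Or.inr (Or.inr ⟨i + 1, by lia, i.2, Or.inr (XXi_succ i.2).symm⟩)
    | Y h => exact Or.inl (YY_eq h).symm
    | Yinv h => exact Or.inr (Or.inl (YYi_eq h).symm)
  | mul a b iha ihb => rw [map_mul]; exact mul_mem iha ihb
  | add a b iha ihb => rw [map_add]; exact add_mem iha ihb

end Presentation

/-- Lemma 13: the two-sided ideal of `BB_n(R)` generated by `e_{n−1}` equals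
`BB_{n−1} e_{n−1} BB_{n−1}`. -/
theorem BB_ideal_span (R : Type) [CommRing R] [IsDomain R]
    (q qi lam lami del deli q0 q0i q1 A x : R)
    (hq : q * qi = 1) (hlam : lam * lami = 1) (hdel : del * deli = 1) (hq0u : q0 * q0i = 1)
    (hdelta : del = q - qi) (hx : x * del = del - lam + lami)
    (hA : A * (1 - q0 * lam) = q1 * x) (hq0 : q0 = qi) (n : ℕ) (hn : 2 ≤ n) :
    ∀ z : BB R lam lami deli q0 q1 A n, z ∈ TwoSidedIdeal.span {ee R lam lami deli q0 q1 A n (n - 1)} ↔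
      z ∈ Submodule.span R {w : BB R lam lami deli q0 q1 A n | ∃ a ∈ sub R lam lami deli q0 q1 A n (n - 2), ∃ b ∈ sub R lam lami deli q0 q1 A n (n - 2),
        w = a * ee R lam lami deli q0 q1 A n (n - 1) * b} := by
  obtain ⟨m, rfl⟩ : ∃ m, n = m + 2 := ⟨n - 2, by lia⟩
  have h := reducedBMW (A := A) (q1 := q1) hlam hdel hq0u (show 0 < m + 2 by lia)
  intro z
  have key := h.mem_span_e_iff (Nat.lt_succ_self m)
    (fun z => sub_eq_genAlg (R := R) (n := m + 2) (m + 1) ▸ mem_sub_top z) z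
  rw [← sub_eq_genAlg, tripleSpan_singleton] at key
  exact key

end BMWB
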